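/- (Existence of a limiting distribution for singular series.) For each fixed integer k ≥ 1 there exists a Borel probability measure ν_k on ℝ, supported on [0,+∞), such that for every bounded continuous function f : ℝ → ℝ, lim_{h→∞} h^{−k} · Σ* f(S(h)) = ∫_ℝ f dν_k, where the sum Σ* runs over all k-tuples h of distinct positive integers with h_i ≤ h. -/

import Mathlib

open Filter Topology

open MeasureTheory

noncomputable def nup {k : ℕ} (h : Fin k → ℕ) (p : ℕ) : ℕ :=
  (Set.range fun i => ((h i : ZMod p))).ncard

/-- The `p`-factor `(1 - ν_p(h)/p) * (1 - 1/p)^(-k)` of the singular series. -/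
noncomputable def singFactor {k : ℕ} (h : Fin k → ℕ) (p : ℕ) : ℝ :=
  (1 - (nup h p : ℝ) / p) * (1 - 1 / (p : ℝ)) ^ (-(k : ℤ))

/-- The singular series `S(h) = ∏_p (1 - ν_p(h)/p)(1 - 1/p)^(-k)`. -/
noncomputable def singSeries {k : ℕ} (h : Fin k → ℕ) : ℝ :=
  ∏' p : Nat.Primes, singFactor h (p : ℕ)

/-- The `k`-tuples of distinct positive integers with all entries `≤ H`. -/
def distinctTuples (k H : ℕ) : Finset (Fin k → ℕ) :=
  (Fintype.piFinset fun _ : Fin k => Finset.Icc 1 H).filter Function.Injective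

theorem abs_prod_le_exp_sum {ι : Type*} (a : ι → ℝ) (G : Finset ι) :
    |∏ p ∈ G, a p| ≤ Real.exp (∑ p ∈ G, |a p - 1|) := by
  rw [Finset.abs_prod]
  calc ∏ p ∈ G, |a p| ≤ ∏ p ∈ G, (1 + |a p - 1|) := by
        refine Finset.prod_le_prod (fun _ _ => abs_nonneg _) fun p _ => ?_
        have := abs_add_le 1 (a p - 1)
        simpa using this
    _ ≤ _ := Real.prod_one_add_le_exp_sum _ fun _ => abs_nonneg _

theorem abs_prod_sub_prod_le {ι : Type*} [DecidableEq ι] (a : ι → ℝ) {F G : Finset ι}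
    (hFG : F ⊆ G) :
    |∏ p ∈ G, a p - ∏ p ∈ F, a p| ≤
      Real.exp (∑ p ∈ F, |a p - 1|) * (Real.exp (∑ p ∈ G \ F, |a p - 1|) - 1) := by
  have h1 : ∏ p ∈ G, a p - ∏ p ∈ F, a p = (∏ p ∈ F, a p) * (∏ p ∈ G \ F, a p - 1) := by
    rw [← Finset.prod_sdiff hFG]; ring
  have h2 := Finset.norm_prod_one_add_sub_one_le (G \ F) fun p => a p - 1
  simp only [add_sub_cancel, Real.norm_eq_abs] at h2
  rw [h1, abs_mul]
  exact mul_le_mul (abs_prod_le_exp_sum a F) h2 (abs_nonneg _) (Real.exp_pos _).le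

theorem multipliable_of_summable_abs_sub_one {ι : Type*} {a : ι → ℝ}
    (hs : Summable fun p => |a p - 1|) : Multipliable a := by
  have := multipliable_one_add_of_summable (f := fun p => a p - 1) (by simpa using hs)
  simpa using this

theorem abs_tprod_le_exp_tsum {ι : Type*} {a : ι → ℝ}
    (hs : Summable fun p => |a p - 1|) : |∏' p, a p| ≤ Real.exp (∑' p, |a p - 1|) := by
  have h : Tendsto (fun G : Finset ι => ∏ p ∈ G, a p) atTop (𝓝 (∏' p, a p)) :=
    (multipliable_of_summable_abs_sub_one hs).hasProd
  refine le_of_tendsto (h.abs) (Eventually.of_forall fun G => ?_)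
  refine (abs_prod_le_exp_sum a G).trans (Real.exp_le_exp.2 ?_)
  exact hs.sum_le_tsum G fun _ _ => abs_nonneg _

theorem abs_tprod_sub_prod_le {ι : Type*} {a : ι → ℝ}
    (hs : Summable fun p => |a p - 1|) (F : Finset ι) :
    |∏' p, a p - ∏ p ∈ F, a p| ≤ Real.exp (∑' p, |a p - 1|) *
      (Real.exp (∑' p, |a p - 1| - ∑ p ∈ F, |a p - 1|) - 1) := by
  classical
  have h : Tendsto (fun G : Finset ι => ∏ p ∈ G, a p) atTop (𝓝 (∏' p, a p)) :=
    (multipliable_of_summable_abs_sub_one hs).hasProd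
  refine le_of_tendsto ((h.sub_const _).abs) ?_
  filter_upwards [eventually_ge_atTop F] with G hG
  have h0 : ∑ p ∈ G \ F, |a p - 1| = ∑ p ∈ G, |a p - 1| - ∑ p ∈ F, |a p - 1| := by
    rw [← Finset.sum_sdiff hG]; ring
  have h1 := hs.sum_le_tsum G fun _ _ => abs_nonneg _
  have h2 := hs.sum_le_tsum F fun _ _ => abs_nonneg _
  have h3 : 0 ≤ ∑ p ∈ G \ F, |a p - 1| := Finset.sum_nonneg fun _ _ => abs_nonneg _
  refine (abs_prod_sub_prod_le a hG).trans ?_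
  refine mul_le_mul (Real.exp_le_exp.2 h2) ?_ ?_ (Real.exp_pos _).le
  · gcongr
    linarith
  · linarith [Real.one_le_exp h3]

theorem sum_tsum_sub_sum_le {α ι : Type*} {T : Finset α} {b : α → ι → ℝ} {v : ι → ℝ}
    (hv : Summable v) (hs : ∀ h ∈ T, Summable (b h)) (hb : ∀ p, ∑ h ∈ T, b h p ≤ v p)
    (F : Finset ι) :
    ∑ h ∈ T, (∑' p, b h p - ∑ p ∈ F, b h p) ≤ ∑' p, v p - ∑ p ∈ F, v p := by
  have hS : Summable fun p => ∑ h ∈ T, b h p := summable_sum hs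
  have h1 := (hv.sub hS).sum_le_tsum F fun p _ => sub_nonneg.2 (hb p)
  rw [hv.tsum_sub hS, Summable.tsum_finsetSum hs, Finset.sum_sub_distrib,
    Finset.sum_comm (s := F)] at h1
  rw [Finset.sum_sub_distrib]
  linarith

theorem exists_forall_card_lt_abs_tprod_le {α ι : Type*} (T : ℕ → Finset α) (N : ℕ → ℝ)
    (a : α → ι → ℝ) {u : ι → ℝ} (hu : Summable u) (hu0 : ∀ p, 0 ≤ u p) (hN : ∀ H, 0 ≤ N H)
    (hs : ∀ H, ∀ h ∈ T H, Summable fun p => |a h p - 1|)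
    (hb : ∀ H p, ∑ h ∈ T H, |a h p - 1| ≤ N H * u p) {ε : ℝ} (hε : 0 < ε) :
    ∃ R : ℝ, ∀ H, (((T H).filter fun h => R < |∏' p, a h p|).card : ℝ) ≤ ε * N H := by
  set U := ∑' p, u p
  have hU : 0 ≤ U := tsum_nonneg hu0
  obtain ⟨K, hK0, hK⟩ : ∃ K : ℝ, 0 < K ∧ U / K ≤ ε := by
    refine ⟨U / ε + 1, by positivity, ?_⟩
    rw [div_le_iff₀ (by positivity)]
    have : ε * (U / ε + 1) = U + ε := by field_simp
    linarith
  refine ⟨Real.exp K, fun H => ?_⟩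
  have h1 := sum_tsum_sub_sum_le (hu.mul_left (N H)) (hs H) (hb H) ∅
  simp only [Finset.sum_empty, sub_zero, tsum_mul_left] at h1
  have h2 : (((T H).filter fun h => Real.exp K < |∏' p, a h p|).card : ℝ) * K ≤
      ∑ h ∈ T H, ∑' p, |a h p - 1| := by
    rw [← nsmul_eq_mul]
    refine (Finset.card_nsmul_le_sum _ (fun h => ∑' p, |a h p - 1|) K fun h hh => ?_).trans
      (Finset.sum_le_sum_of_subset_of_nonneg (Finset.filter_subset _ _)
        fun _ _ _ => tsum_nonneg fun _ => abs_nonneg _)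
    rw [Finset.mem_filter] at hh
    exact (Real.exp_lt_exp.1 (hh.2.trans_le (abs_tprod_le_exp_tsum (hs H h hh.1)))).le
  have h3 : (((T H).filter fun h => Real.exp K < |∏' p, a h p|).card : ℝ) ≤ N H * U / K := by
    rw [le_div_iff₀ hK0]; exact h2.trans h1
  refine h3.trans ?_
  rw [mul_div_assoc, mul_comm]
  exact mul_le_mul_of_nonneg_right hK (hN H)

theorem exists_finset_forall_abs_sum_sub_sum_le {α ι : Type*} (T : ℕ → Finset α) (N : ℕ → ℝ)
    (a : α → ι → ℝ) {u : ι → ℝ} (hu : Summable u) (hu0 : ∀ p, 0 ≤ u p)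
    (hcard : ∀ H, ((T H).card : ℝ) ≤ N H)
    (hs : ∀ H, ∀ h ∈ T H, Summable fun p => |a h p - 1|)
    (hb : ∀ H p, ∑ h ∈ T H, |a h p - 1| ≤ N H * u p) {f : ℝ → ℝ} (hf : Continuous f) {M : ℝ}
    (hM : ∀ x, |f x| ≤ M) {ε : ℝ} (hε : 0 < ε) :
    ∃ F : Finset ι, ∀ H,
      |∑ h ∈ T H, f (∏' p, a h p) - ∑ h ∈ T H, f (∏ p ∈ F, a h p)| ≤ ε * N H := by
  have hM0 : 0 ≤ M := (abs_nonneg _).trans (hM 0)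
  have hN : ∀ H, 0 ≤ N H := fun H => (Nat.cast_nonneg _).trans (hcard H)
  set U := ∑' p, u p with hUdef
  have hU : 0 ≤ U := tsum_nonneg hu0
  obtain ⟨K, hK0, hK⟩ : ∃ K : ℝ, 0 < K ∧ 2 * M * U / K ≤ ε / 4 := by
    refine ⟨2 * M * U / (ε / 4) + 1, by positivity, ?_⟩
    rw [div_le_iff₀ (by positivity)]
    have : ε / 4 * (2 * M * U / (ε / 4) + 1) = 2 * M * U + ε / 4 := by field_simp
    linarith
  obtain ⟨δ, hδ0, hδ⟩ : ∃ δ > 0, ∀ x ∈ Set.Icc (-Real.exp K) (Real.exp K),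
      ∀ y ∈ Set.Icc (-Real.exp K) (Real.exp K), dist x y < δ → dist (f x) (f y) < ε / 2 :=
    Metric.uniformContinuousOn_iff.1
      (isCompact_Icc.uniformContinuousOn_of_continuous hf.continuousOn) _ (half_pos hε)
  obtain ⟨η, hη0, hη⟩ : ∃ η : ℝ, 0 < η ∧ Real.exp K * (Real.exp η - 1) < δ := by
    have hc : Tendsto (fun x : ℝ => Real.exp K * (Real.exp x - 1)) (𝓝[>] 0) (𝓝 0) := by
      have : Continuous fun x : ℝ => Real.exp K * (Real.exp x - 1) := by fun_prop
      simpa using (this.tendsto 0).mono_left nhdsWithin_le_nhds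
    obtain ⟨x, hx⟩ := ((hc.eventually (gt_mem_nhds hδ0)).and self_mem_nhdsWithin).exists
    exact ⟨x, hx.2, hx.1⟩
  obtain ⟨F, hF⟩ : ∃ F : Finset ι, 2 * M * (U - ∑ p ∈ F, u p) / η ≤ ε / 4 := by
    have hc : Tendsto (fun F : Finset ι => 2 * M * (U - ∑ p ∈ F, u p) / η) atTop
        (𝓝 (2 * M * (U - U) / η)) :=
      ((hu.hasSum.const_sub U).const_mul _).div_const _
    rw [sub_self, mul_zero, zero_div] at hc
    obtain ⟨F, hF⟩ := (hc.eventually (gt_mem_nhds (show 0 < ε / 4 by positivity))).exists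
    exact ⟨F, hF.le⟩
  refine ⟨F, fun H => ?_⟩
  set B : α → ℝ := fun h => ∑' p, |a h p - 1|
  set Q : α → ℝ := fun h => ∑' p, |a h p - 1| - ∑ p ∈ F, |a h p - 1|
  have hpt : ∀ h ∈ T H, |f (∏' p, a h p) - f (∏ p ∈ F, a h p)| ≤
      ε / 2 + 2 * M / K * B h + 2 * M / η * Q h := by
    intro h hh
    have hB : 0 ≤ B h := tsum_nonneg fun _ => abs_nonneg _
    have hFB : ∑ p ∈ F, |a h p - 1| ≤ B h := (hs H h hh).sum_le_tsum F fun _ _ => abs_nonneg _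
    have hQ : 0 ≤ Q h := sub_nonneg.2 hFB
    have htriv : |f (∏' p, a h p) - f (∏ p ∈ F, a h p)| ≤ 2 * M :=
      (abs_sub _ _).trans (by linarith [hM (∏' p, a h p), hM (∏ p ∈ F, a h p)])
    have e1 : 0 ≤ 2 * M / K * B h := by positivity
    have e2 : 0 ≤ 2 * M / η * Q h := by positivity
    rcases lt_or_ge K (B h) with hBK | hBK
    · have : 2 * M ≤ 2 * M / K * B h := by
        rw [div_mul_eq_mul_div, le_div_iff₀ hK0]
        exact mul_le_mul_of_nonneg_left hBK.le (by positivity)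
      linarith
    rcases lt_or_ge η (Q h) with hQη | hQη
    · have : 2 * M ≤ 2 * M / η * Q h := by
        rw [div_mul_eq_mul_div, le_div_iff₀ hη0]
        exact mul_le_mul_of_nonneg_left hQη.le (by positivity)
      linarith
    have i1 : |∏' p, a h p| ≤ Real.exp K :=
      (abs_tprod_le_exp_tsum (hs H h hh)).trans (Real.exp_le_exp.2 hBK)
    have i2 : |∏ p ∈ F, a h p| ≤ Real.exp K :=
      (abs_prod_le_exp_sum _ _).trans (Real.exp_le_exp.2 (hFB.trans hBK))
    have i3 : |∏' p, a h p - ∏ p ∈ F, a h p| < δ := by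
      refine lt_of_le_of_lt ((abs_tprod_sub_prod_le (hs H h hh) F).trans ?_) hη
      refine mul_le_mul (Real.exp_le_exp.2 hBK) ?_ ?_ (Real.exp_pos _).le
      · exact sub_le_sub_right (Real.exp_le_exp.2 hQη) _
      · linarith [Real.one_le_exp hQ]
    have := hδ _ (abs_le.1 i1) _ (abs_le.1 i2) i3
    rw [Real.dist_eq] at this
    linarith
  have s1 : ∑ h ∈ T H, B h ≤ N H * U := by
    have h1 := sum_tsum_sub_sum_le (hu.mul_left (N H)) (hs H) (hb H) ∅
    simpa only [Finset.sum_empty, sub_zero, tsum_mul_left] using h1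
  have s2 : ∑ h ∈ T H, Q h ≤ N H * (U - ∑ p ∈ F, u p) := by
    have h1 := sum_tsum_sub_sum_le (hu.mul_left (N H)) (hs H) (hb H) F
    rwa [tsum_mul_left, ← Finset.mul_sum, ← mul_sub] at h1
  rw [← Finset.sum_sub_distrib]
  calc |∑ h ∈ T H, (f (∏' p, a h p) - f (∏ p ∈ F, a h p))|
      ≤ ∑ h ∈ T H, (ε / 2 + 2 * M / K * B h + 2 * M / η * Q h) :=
        (Finset.abs_sum_le_sum_abs _ _).trans (Finset.sum_le_sum hpt)
    _ = (T H).card * (ε / 2) + 2 * M / K * ∑ h ∈ T H, B h + 2 * M / η * ∑ h ∈ T H, Q h := by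
        rw [Finset.sum_add_distrib, Finset.sum_add_distrib, ← Finset.mul_sum, ← Finset.mul_sum,
          Finset.sum_const, nsmul_eq_mul]
    _ ≤ N H * (ε / 2) + 2 * M / K * (N H * U) + 2 * M / η * (N H * (U - ∑ p ∈ F, u p)) := by
        gcongr
        exact hcard H
    _ = N H * (ε / 2 + 2 * M * U / K + 2 * M * (U - ∑ p ∈ F, u p) / η) := by ring
    _ ≤ N H * ε := mul_le_mul_of_nonneg_left (by linarith) (hN H)
    _ = ε * N H := mul_comm _ _

theorem abs_card_filter_modEq_sub_le (H v : ℕ) {r : ℕ} (hr : 0 < r) :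
    |(((Finset.Icc 1 H).filter fun x => x ≡ v [MOD r]).card : ℝ) - H / r| ≤ 1 := by
  have hI : Finset.Icc 1 H = Finset.Ioc 0 H := by ext; simp [Nat.succ_le_iff]
  have h := Nat.Ioc_filter_modEq_card 0 H hr v
  rw [← hI] at h
  have hr' : (0 : ℚ) < r := by exact_mod_cast hr
  set c := ((Finset.Icc 1 H).filter fun x => x ≡ v [MOD r]).card
  set x : ℚ := ((H : ℚ) - v) / r with hx
  set y : ℚ := (((0 : ℕ) : ℚ) - v) / r with hy
  have hxy : x - y = H / r := by rw [hx, hy]; push_cast; ring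
  have hyx : y ≤ x := by
    have : (0 : ℚ) ≤ H / r := by positivity
    linarith
  rw [max_eq_left (sub_nonneg.2 (Int.floor_le_floor hyx))] at h
  have hq : (c : ℚ) = (⌊x⌋ : ℚ) - ⌊y⌋ := by exact_mod_cast congrArg (Int.cast : ℤ → ℚ) h
  have key : |(c : ℚ) - H / r| ≤ 1 := by
    rw [abs_le]
    constructor <;> linarith [Int.floor_le x, Int.lt_floor_add_one x, Int.floor_le y,
      Int.lt_floor_add_one y]
  have key' : |(((c : ℚ) - H / r : ℚ) : ℝ)| ≤ 1 := by exact_mod_cast key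
  simpa using key'

theorem card_filter_ne_modEq_le (H a : ℕ) {r : ℕ} (hr : 0 < r) (ha : a ∈ Finset.Icc 1 H) :
    ((Finset.Icc 1 H).filter fun x => a ≠ x ∧ x ≡ a [MOD r]).card ≤ H / r := by
  have h1 := (abs_le.1 (abs_card_filter_modEq_sub_le H a hr)).2
  have h2 : ((Finset.Icc 1 H).filter fun x => a ≠ x ∧ x ≡ a [MOD r]).card + 1 ≤
      ((Finset.Icc 1 H).filter fun x => x ≡ a [MOD r]).card := by
    refine Finset.card_lt_card (Finset.ssubset_iff_of_subset ?_ |>.2 ⟨a, ?_, ?_⟩)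
    · intro x hx
      simp only [Finset.mem_filter] at hx ⊢
      exact ⟨hx.1, hx.2.2⟩
    · exact Finset.mem_filter.2 ⟨ha, Nat.ModEq.refl _⟩
    · simp
  rw [Nat.le_div_iff_mul_le hr]
  have hr' : (0 : ℝ) < r := by exact_mod_cast hr
  have h3 : ((((Finset.Icc 1 H).filter fun x => a ≠ x ∧ x ≡ a [MOD r]).card : ℕ) : ℝ) + 1 ≤
      ((Finset.Icc 1 H).filter fun x => x ≡ a [MOD r]).card := by exact_mod_cast h2
  have h4 : ((((Finset.Icc 1 H).filter fun x => a ≠ x ∧ x ≡ a [MOD r]).card : ℕ) : ℝ) ≤ H / r := by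
    linarith
  rw [le_div_iff₀ hr'] at h4
  exact_mod_cast h4

theorem card_le_mul_pow_of_forall_fiber {k H c : ℕ} {S : Finset (Fin k → ℕ)}
    (hS : S ⊆ Fintype.piFinset fun _ : Fin k => Finset.Icc 1 H) {i j : Fin k} (hij : i ≠ j)
    (Q : ℕ → ℕ → Prop) [DecidableRel Q] (hQ : ∀ h ∈ S, Q (h i) (h j))
    (hc : ∀ a ∈ Finset.Icc 1 H, ((Finset.Icc 1 H).filter (Q a)).card ≤ c) :
    S.card ≤ c * H ^ (k - 1) := by
  have hmaps : ∀ h ∈ S, (fun l : {l // l ≠ j} => h l) ∈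
      Fintype.piFinset fun _ : {l // l ≠ j} => Finset.Icc 1 H := by
    intro h hh
    rw [Fintype.mem_piFinset]
    exact fun l => Fintype.mem_piFinset.1 (hS hh) l
  have h1 := Finset.card_le_mul_card_image_of_maps_to hmaps c fun g hg => by
    refine le_trans ?_ (hc (g ⟨i, hij⟩) (Fintype.mem_piFinset.1 hg _))
    refine Finset.card_le_card_of_injOn (fun h => h j) ?_ ?_
    · intro h hh
      rw [Finset.mem_coe, Finset.mem_filter] at hh
      rw [Finset.mem_coe, Finset.mem_filter, ← hh.2]
      exact ⟨Fintype.mem_piFinset.1 (hS hh.1) j, hQ h hh.1⟩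
    · intro h hh h' hh' e
      rw [Finset.mem_coe, Finset.mem_filter] at hh hh'
      ext l
      by_cases hl : l = j
      · subst hl; exact e
      · exact congrFun (hh.2.trans hh'.2.symm) ⟨l, hl⟩
  simpa [Fintype.card_piFinset] using h1

theorem distinctTuples_subset (k H : ℕ) :
    distinctTuples k H ⊆ Fintype.piFinset fun _ : Fin k => Finset.Icc 1 H :=
  Finset.filter_subset _ _

theorem card_distinctTuples_le (k H : ℕ) : ((distinctTuples k H).card : ℝ) ≤ (H : ℝ) ^ k := by
  have := Finset.card_le_card (distinctTuples_subset k H)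
  rw [Fintype.card_piFinset] at this
  simp only [Nat.card_Icc, add_tsub_cancel_right, Finset.prod_const, Finset.card_univ,
    Fintype.card_fin] at this
  exact_mod_cast this

theorem card_sdiff_distinctTuples_le (k H : ℕ) :
    (((Fintype.piFinset fun _ : Fin k => Finset.Icc 1 H) \ distinctTuples k H).card : ℝ) ≤
      (k : ℝ) ^ 2 * (H : ℝ) ^ (k - 1) := by
  have hsub : (Fintype.piFinset fun _ : Fin k => Finset.Icc 1 H) \ distinctTuples k H ⊆
      (Finset.univ.filter fun q : Fin k × Fin k => q.1 ≠ q.2).biUnion fun q =>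
        (Fintype.piFinset fun _ : Fin k => Finset.Icc 1 H).filter fun h => h q.1 = h q.2 := by
    intro h hh
    simp only [distinctTuples, Finset.mem_sdiff, Finset.mem_filter, not_and] at hh
    have hn := hh.2 hh.1
    rw [Function.not_injective_iff] at hn
    obtain ⟨i, j, h1, h2⟩ := hn
    exact Finset.mem_biUnion.2 ⟨(i, j), by simpa using h2, Finset.mem_filter.2 ⟨hh.1, h1⟩⟩
  have h1 := (Finset.card_le_card hsub).trans (Finset.card_biUnion_le_card_mul _ _ (H ^ (k - 1))
    fun q hq => by
      have := card_le_mul_pow_of_forall_fiber (H := H) (c := 1) (Finset.filter_subset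
        (fun h : Fin k → ℕ => h q.1 = h q.2) _) (Finset.mem_filter.1 hq).2 (fun a b => a = b)
        (fun h hh => (Finset.mem_filter.1 hh).2) (fun a _ => by
          refine Finset.card_le_one.2 fun x hx y hy => ?_
          exact (Finset.mem_filter.1 hx).2.symm.trans (Finset.mem_filter.1 hy).2)
      simpa using this)
  have h2 : (Finset.univ.filter fun q : Fin k × Fin k => q.1 ≠ q.2).card ≤ k ^ 2 := by
    refine (Finset.card_filter_le _ _).trans ?_
    simp [sq]
  have h3 := h1.trans (Nat.mul_le_mul_right _ h2)
  exact_mod_cast h3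

/-- The number of ordered pairs of distinct indices at which `h` takes congruent values. -/
def collisions {k : ℕ} (h : Fin k → ℕ) (p : ℕ) : ℕ :=
  (Finset.univ.filter fun q : Fin k × Fin k => q.1 ≠ q.2 ∧ h q.2 ≡ h q.1 [MOD p]).card

theorem sum_collisions_le {k : ℕ} (hk : 1 ≤ k) (H : ℕ) {p : ℕ} (hp : 0 < p) :
    ∑ h ∈ distinctTuples k H, (collisions h p : ℝ) ≤ (k : ℝ) ^ 2 * ((H : ℝ) ^ k / p) := by
  have h1 : ∑ h ∈ distinctTuples k H, collisions h p =
      ∑ q : Fin k × Fin k, ((distinctTuples k H).filter fun h =>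
        q.1 ≠ q.2 ∧ h q.2 ≡ h q.1 [MOD p]).card := by
    simp only [collisions, Finset.card_filter]
    exact Finset.sum_comm
  have h2 : ∀ q : Fin k × Fin k, (((distinctTuples k H).filter fun h =>
        q.1 ≠ q.2 ∧ h q.2 ≡ h q.1 [MOD p]).card : ℝ) ≤ (H : ℝ) ^ k / p := by
    intro q
    by_cases hq : q.1 = q.2
    · simp only [hq, ne_eq, not_true_eq_false, false_and, Finset.filter_false,
        Finset.card_empty, Nat.cast_zero]
      positivity
    have := card_le_mul_pow_of_forall_fiber (H := H) (c := H / p)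
      ((Finset.filter_subset (fun h : Fin k → ℕ => q.1 ≠ q.2 ∧ h q.2 ≡ h q.1 [MOD p])
        _).trans (distinctTuples_subset k H)) hq (fun a b => a ≠ b ∧ b ≡ a [MOD p])
      (fun h hh => by
        rw [Finset.mem_filter] at hh
        exact ⟨fun e => hq ((Finset.mem_filter.1 hh.1).2 e), hh.2.2⟩)
      (fun a ha => card_filter_ne_modEq_le H a hp ha)
    calc _ ≤ (((H / p * H ^ (k - 1) : ℕ)) : ℝ) := by exact_mod_cast this
      _ ≤ (H : ℝ) / p * (H : ℝ) ^ (k - 1) := by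
        push_cast
        exact mul_le_mul_of_nonneg_right Nat.cast_div_le (by positivity)
      _ = (H : ℝ) ^ k / p := by
        rw [div_mul_eq_mul_div, ← pow_succ', Nat.sub_add_cancel hk]
  calc ∑ h ∈ distinctTuples k H, (collisions h p : ℝ)
      = ∑ q : Fin k × Fin k, (((distinctTuples k H).filter fun h =>
        q.1 ≠ q.2 ∧ h q.2 ≡ h q.1 [MOD p]).card : ℝ) := by exact_mod_cast h1
    _ ≤ ∑ _q : Fin k × Fin k, (H : ℝ) ^ k / p := Finset.sum_le_sum fun q _ => h2 q
    _ = _ := by simp [sq]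

theorem nup_le {k : ℕ} (h : Fin k → ℕ) (p : ℕ) : nup h p ≤ k := by
  unfold nup
  rw [← Set.image_univ]
  refine (Set.ncard_image_le Set.finite_univ).trans ?_
  simp

theorem nup_le_prime {k : ℕ} (h : Fin k → ℕ) {p : ℕ} (hp : p ≠ 0) : nup h p ≤ p := by
  have : NeZero p := ⟨hp⟩
  unfold nup
  refine (Set.ncard_le_ncard (Set.subset_univ _) Set.finite_univ).trans ?_
  simp [Set.ncard_univ]

theorem sub_nup_le {k : ℕ} (h : Fin k → ℕ) (p : ℕ) :
    (k : ℝ) - nup h p ≤ k * collisions h p := by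
  rcases Nat.eq_zero_or_pos (collisions h p) with h0 | h0
  · have hinj : Function.Injective fun i => (h i : ZMod p) := by
      intro i j hij
      by_contra hne
      have : (i, j) ∈ Finset.univ.filter fun q : Fin k × Fin k =>
          q.1 ≠ q.2 ∧ h q.2 ≡ h q.1 [MOD p] := by
        simp only [Finset.mem_filter, Finset.mem_univ, true_and]
        exact ⟨hne, ((ZMod.natCast_eq_natCast_iff _ _ _).1 hij).symm⟩
      rw [collisions, Finset.card_eq_zero] at h0
      simp [h0] at this
    have : nup h p = k := by
      unfold nup
      rw [← Set.image_univ, Set.ncard_image_of_injective _ hinj, Set.ncard_univ]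
      simp
    simp [this, h0]
  · have : (1 : ℝ) ≤ collisions h p := by exact_mod_cast h0
    have h2 : (0 : ℝ) ≤ k := by positivity
    have h3 : (0 : ℝ) ≤ nup h p := by positivity
    nlinarith

theorem one_sub_pow_le {x : ℝ} (h0 : 0 ≤ x) (h1 : x ≤ 1) (k : ℕ) :
    (1 - x) ^ k ≤ 1 - k * x + (k : ℝ) ^ 2 * x ^ 2 := by
  induction k with
  | zero => simp
  | succ n ih =>
    rw [pow_succ]
    have h2 := mul_le_mul_of_nonneg_right ih (sub_nonneg.2 h1)
    have h3 : (0 : ℝ) ≤ n ^ 2 * x ^ 3 := by positivity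
    have h4 : (0 : ℝ) ≤ (n + 1) * x ^ 2 := by positivity
    push_cast
    nlinarith

theorem abs_singFactor_sub_one_le {k : ℕ} (h : Fin k → ℕ) {p : ℕ} (hp : p.Prime) :
    |singFactor h p - 1| ≤
      2 ^ k * ((k : ℝ) ^ 2 * (1 / (p : ℝ)) ^ 2 + k * (collisions h p * (1 / p))) := by
  have hp2 : (2 : ℝ) ≤ p := by exact_mod_cast hp.two_le
  set x : ℝ := 1 / p with hx
  have hx0 : 0 ≤ x := by positivity
  have hx2 : x ≤ 1 / 2 := one_div_le_one_div_of_le (by norm_num) hp2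
  have hpos : 0 < (1 - x) ^ k := pow_pos (by linarith) _
  have hinv : ((1 - x) ^ k)⁻¹ ≤ 2 ^ k := by
    rw [← inv_pow]
    refine pow_le_pow_left₀ (inv_nonneg.2 (by linarith)) ?_ _
    rw [inv_le_comm₀ (by linarith) (by norm_num)]
    linarith
  have heq : singFactor h p - 1 = (1 - nup h p * x - (1 - x) ^ k) * ((1 - x) ^ k)⁻¹ := by
    have h1 : (nup h p : ℝ) / p = nup h p * x := by rw [hx, mul_one_div]
    rw [singFactor, h1, ← hx, zpow_neg, zpow_natCast, sub_mul _ ((1 - x) ^ k),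
      mul_inv_cancel₀ hpos.ne']
  have hB : 1 - k * x ≤ (1 - x) ^ k := by
    have := one_add_mul_le_pow (a := -x) (by linarith) k
    calc 1 - k * x = 1 + k * (-x) := by ring
      _ ≤ (1 + -x) ^ k := this
      _ = (1 - x) ^ k := by rw [← sub_eq_add_neg]
  have hU := one_sub_pow_le hx0 (by linarith) k
  have hn : (nup h p : ℝ) ≤ k := by exact_mod_cast nup_le h p
  have h1 := mul_le_mul_of_nonneg_right (sub_nup_le h p) hx0
  have h2 := mul_le_mul_of_nonneg_right hn hx0
  have h3 : 0 ≤ (k : ℝ) * collisions h p * x := by positivity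
  have h4 : 0 ≤ (k : ℝ) ^ 2 * x ^ 2 := by positivity
  have habs : |1 - nup h p * x - (1 - x) ^ k| ≤
      (k : ℝ) ^ 2 * x ^ 2 + k * (collisions h p * x) := by
    rw [abs_le]
    constructor <;> nlinarith
  rw [heq, abs_mul, abs_of_pos (inv_pos.2 hpos), mul_comm]
  exact mul_le_mul hinv habs (abs_nonneg _) (by positivity)

theorem singFactor_nonneg {k : ℕ} (h : Fin k → ℕ) {p : ℕ} (hp : p.Prime) :
    0 ≤ singFactor h p := by
  have hp1 : (1 : ℝ) ≤ p := by exact_mod_cast hp.one_lt.le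
  have h1 : (nup h p : ℝ) ≤ p := by exact_mod_cast nup_le_prime h hp.ne_zero
  unfold singFactor
  refine mul_nonneg (sub_nonneg.2 ((div_le_one (by linarith)).2 h1)) (zpow_nonneg ?_ _)
  exact sub_nonneg.2 ((div_le_one (by linarith)).2 hp1)

theorem collisions_eq_zero {k : ℕ} {h : Fin k → ℕ} (hh : Function.Injective h) {p : ℕ}
    (hp : ∀ i, h i < p) : collisions h p = 0 := by
  rw [collisions, Finset.card_eq_zero, Finset.filter_eq_empty_iff]
  rintro ⟨i, j⟩ - ⟨h1, h2⟩
  exact h1 (hh (Nat.ModEq.eq_of_lt_of_lt h2 (hp j) (hp i))).symm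

theorem summable_one_div_primes_sq : Summable fun p : Nat.Primes => (1 / ((p : ℕ) : ℝ)) ^ 2 := by
  have := (Real.summable_one_div_nat_pow (p := 2)).2 (by norm_num)
  refine (this.comp_injective Nat.Primes.coe_nat_injective).congr fun p => ?_
  simp

theorem summable_abs_singFactor_sub_one {k : ℕ} {h : Fin k → ℕ} (hh : Function.Injective h) :
    Summable fun p : Nat.Primes => |singFactor h p - 1| := by
  refine Summable.of_nonneg_of_le (fun _ => abs_nonneg _)
    (fun p => abs_singFactor_sub_one_le h p.2) (Summable.mul_left _ (Summable.add
      (summable_one_div_primes_sq.mul_left _) (Summable.mul_left _ ?_)))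
  refine summable_of_hasFiniteSupport ?_
  have hfin : (Set.Iic (∑ i, h i)).Finite := Set.finite_Iic _
  refine (hfin.preimage (Nat.Primes.coe_nat_injective.injOn)).subset fun p hp => ?_
  by_contra hlt
  simp only [Set.mem_preimage, Set.mem_Iic, not_le] at hlt
  refine hp ?_
  have : collisions h p = 0 := collisions_eq_zero hh fun i =>
    (Finset.single_le_sum (f := h) (fun _ _ => Nat.zero_le _) (Finset.mem_univ i)).trans_lt hlt
  simp [this]

theorem sum_abs_singFactor_sub_one_le {k : ℕ} (hk : 1 ≤ k) (H : ℕ) {p : ℕ} (hp : p.Prime) :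
    ∑ h ∈ distinctTuples k H, |singFactor h p - 1| ≤
      (H : ℝ) ^ k * (2 ^ k * ((k : ℝ) ^ 2 + (k : ℝ) ^ 3) * (1 / (p : ℝ)) ^ 2) := by
  have hp0 : (0 : ℝ) < p := by exact_mod_cast hp.pos
  have h1 := sum_collisions_le hk H hp.pos
  have h2 := card_distinctTuples_le k H
  calc ∑ h ∈ distinctTuples k H, |singFactor h p - 1|
      ≤ ∑ h ∈ distinctTuples k H,
        2 ^ k * ((k : ℝ) ^ 2 * (1 / (p : ℝ)) ^ 2 + k * (collisions h p * (1 / p))) :=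
        Finset.sum_le_sum fun h _ => abs_singFactor_sub_one_le h hp
    _ = 2 ^ k * ((distinctTuples k H).card * ((k : ℝ) ^ 2 * (1 / (p : ℝ)) ^ 2) +
        k * ((∑ h ∈ distinctTuples k H, (collisions h p : ℝ)) * (1 / p))) := by
        rw [← Finset.mul_sum, Finset.sum_add_distrib, Finset.sum_const, nsmul_eq_mul,
          ← Finset.mul_sum, Finset.sum_mul]
    _ ≤ 2 ^ k * ((H : ℝ) ^ k * ((k : ℝ) ^ 2 * (1 / (p : ℝ)) ^ 2) +
        k * (((k : ℝ) ^ 2 * ((H : ℝ) ^ k / p)) * (1 / p))) := by gcongr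
    _ = _ := by ring

theorem tendsto_card_filter_modEq_div (v : ℕ) {r : ℕ} (hr : 0 < r) :
    Tendsto (fun H : ℕ => (((Finset.Icc 1 H).filter fun x => x ≡ v [MOD r]).card : ℝ) / H)
      atTop (𝓝 (1 / r)) := by
  rw [tendsto_iff_norm_sub_tendsto_zero]
  refine squeeze_zero' (Eventually.of_forall fun _ => norm_nonneg _) ?_
    tendsto_one_div_atTop_nhds_zero_nat
  filter_upwards [eventually_gt_atTop 0] with H hH
  have hH' : (0 : ℝ) < H := by exact_mod_cast hH
  have hr' : (0 : ℝ) < r := by exact_mod_cast hr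
  have h := abs_card_filter_modEq_sub_le H v hr
  set c : ℝ := (((Finset.Icc 1 H).filter fun x => x ≡ v [MOD r]).card : ℝ)
  have e : c / H - 1 / r = (c - H / r) / H := by field_simp
  rw [Real.norm_eq_abs, e, abs_div, abs_of_pos hH']
  exact div_le_div_of_nonneg_right h hH'.le

theorem exists_tendsto_mean_of_periodic {k : ℕ} (g : (Fin k → ℕ) → ℝ) {r : ℕ} (hr : 0 < r)
    (hg : ∀ h : Fin k → ℕ, g h = g fun i => h i % r) :
    ∃ L : ℝ, Tendsto
      (fun H : ℕ => (∑ h ∈ Fintype.piFinset fun _ : Fin k => Finset.Icc 1 H, g h) / (H : ℝ) ^ k)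
      atTop (𝓝 L) := by
  have key : ∀ H : ℕ,
      (∑ h ∈ Fintype.piFinset fun _ : Fin k => Finset.Icc 1 H, g h) / (H : ℝ) ^ k =
        ∑ v ∈ Fintype.piFinset fun _ : Fin k => Finset.range r,
          g v * ∏ i, ((((Finset.Icc 1 H).filter fun x => x ≡ v i [MOD r]).card : ℝ) / H) := by
    intro H
    have hmaps : ∀ h ∈ Fintype.piFinset fun _ : Fin k => Finset.Icc 1 H,
        (fun i => h i % r) ∈ Fintype.piFinset fun _ : Fin k => Finset.range r := fun h _ =>
      Fintype.mem_piFinset.2 fun i => Finset.mem_range.2 (Nat.mod_lt _ hr)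
    rw [← Finset.sum_fiberwise_of_maps_to hmaps, Finset.sum_div]
    refine Finset.sum_congr rfl fun v hv => ?_
    have hfib : ((Fintype.piFinset fun _ : Fin k => Finset.Icc 1 H).filter
        fun h => (fun i => h i % r) = v) =
        Fintype.piFinset fun i => (Finset.Icc 1 H).filter fun x => x ≡ v i [MOD r] := by
      ext h
      simp only [Finset.mem_filter, Fintype.mem_piFinset, funext_iff, ← forall_and]
      refine forall_congr' fun i => and_congr_right fun _ => ?_
      rw [Nat.ModEq, Nat.mod_eq_of_lt (Finset.mem_range.1 (Fintype.mem_piFinset.1 hv i))]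
    have hconst : ∀ h ∈ (Fintype.piFinset fun _ : Fin k => Finset.Icc 1 H).filter
        fun h => (fun i => h i % r) = v, g h = g v := by
      intro h hh
      rw [hg h, (Finset.mem_filter.1 hh).2]
    rw [Finset.sum_congr rfl hconst, Finset.sum_const, hfib, Fintype.card_piFinset, nsmul_eq_mul,
      Finset.prod_div_distrib]
    simp only [Nat.cast_prod, Finset.prod_const, Finset.card_univ, Fintype.card_fin]
    ring
  refine ⟨_, (tendsto_finsetSum _ fun v _ => (tendsto_finsetProd _ fun i _ =>
    tendsto_card_filter_modEq_div (v i) hr).const_mul (g v)).congr fun H => (key H).symm⟩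

theorem tendsto_sum_sub_sum_distinctTuples {k : ℕ} (hk : 1 ≤ k) (g : (Fin k → ℕ) → ℝ) {M : ℝ}
    (hM : ∀ h, |g h| ≤ M) :
    Tendsto (fun H : ℕ =>
      (∑ h ∈ Fintype.piFinset fun _ : Fin k => Finset.Icc 1 H, g h) / (H : ℝ) ^ k -
        (∑ h ∈ distinctTuples k H, g h) / (H : ℝ) ^ k) atTop (𝓝 0) := by
  have hlim : Tendsto (fun H : ℕ => (k : ℝ) ^ 2 * M * (1 / (H : ℝ))) atTop (𝓝 0) := by
    simpa using (tendsto_one_div_atTop_nhds_zero_nat (𝕜 := ℝ)).const_mul ((k : ℝ) ^ 2 * M)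
  refine squeeze_zero_norm' ?_ hlim
  filter_upwards [eventually_gt_atTop 0] with H hH
  have hH' : (0 : ℝ) < H := by exact_mod_cast hH
  have hM0 : 0 ≤ M := (abs_nonneg _).trans (hM fun _ => 0)
  rw [← sub_div, ← Finset.sum_sdiff (distinctTuples_subset k H), add_sub_cancel_right,
    Real.norm_eq_abs, abs_div, abs_of_pos (pow_pos hH' k), div_le_iff₀ (pow_pos hH' k)]
  calc _ ≤ ∑ h ∈ (Fintype.piFinset fun _ : Fin k => Finset.Icc 1 H) \ distinctTuples k H, |g h| :=
        Finset.abs_sum_le_sum_abs _ _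
    _ ≤ (((Fintype.piFinset fun _ : Fin k => Finset.Icc 1 H) \ distinctTuples k H).card : ℝ) * M := by
        rw [← nsmul_eq_mul]
        exact Finset.sum_le_card_nsmul _ _ _ fun h _ => hM h
    _ ≤ (k : ℝ) ^ 2 * (H : ℝ) ^ (k - 1) * M :=
        mul_le_mul_of_nonneg_right (card_sdiff_distinctTuples_le k H) hM0
    _ = (k : ℝ) ^ 2 * M * (1 / (H : ℝ)) * ((H : ℝ) ^ (k - 1) * H) := by field_simp
    _ = _ := by rw [← pow_succ, Nat.sub_add_cancel hk]

theorem tendsto_card_distinctTuples_div {k : ℕ} (hk : 1 ≤ k) :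
    Tendsto (fun H : ℕ => ((distinctTuples k H).card : ℝ) / (H : ℝ) ^ k) atTop (𝓝 1) := by
  have h := (tendsto_sum_sub_sum_distinctTuples hk (fun _ => 1) (M := 1) (by simp)).const_sub 1
  rw [sub_zero] at h
  refine h.congr' ?_
  filter_upwards [eventually_gt_atTop 0] with H hH
  have hH' : (H : ℝ) ^ k ≠ 0 := by positivity
  simp [Fintype.card_piFinset, div_self hH']

theorem singFactor_mod {k : ℕ} (h : Fin k → ℕ) {p r : ℕ} (hpr : p ∣ r) :
    singFactor (fun i => h i % r) p = singFactor h p := by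
  have : ∀ i, ((h i % r : ℕ) : ZMod p) = h i := fun i =>
    (ZMod.natCast_eq_natCast_iff _ _ _).2 ((Nat.mod_modEq (h i) r).of_dvd hpr)
  simp only [singFactor, nup, this]

theorem exists_tendsto_mean_comp_prod_singFactor {k : ℕ} (hk : 1 ≤ k) (F : Finset Nat.Primes)
    {f : ℝ → ℝ} {M : ℝ} (hM : ∀ x, |f x| ≤ M) :
    ∃ L : ℝ, Tendsto (fun H : ℕ =>
      (∑ h ∈ distinctTuples k H, f (∏ p ∈ F, singFactor h p)) / (H : ℝ) ^ k) atTop (𝓝 L) := by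
  obtain ⟨L, hL⟩ := exists_tendsto_mean_of_periodic
    (fun h : Fin k → ℕ => f (∏ p ∈ F, singFactor h p)) (r := ∏ p ∈ F, (p : ℕ))
    (Finset.prod_pos fun p _ => p.2.pos) (fun h => by
      refine congrArg f (Finset.prod_congr rfl fun p hp => ?_)
      exact (singFactor_mod h (Finset.dvd_prod_of_mem (fun p : Nat.Primes => (p : ℕ)) hp)).symm)
  refine ⟨L - 0, (hL.sub (tendsto_sum_sub_sum_distinctTuples hk
    (fun h : Fin k → ℕ => f (∏ p ∈ F, singFactor h p)) fun h => hM _)).congr fun H => ?_⟩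
  ring

theorem singSeries_nonneg {k : ℕ} {h : Fin k → ℕ} (hh : Function.Injective h) :
    0 ≤ singSeries h :=
  ge_of_tendsto (multipliable_of_summable_abs_sub_one (summable_abs_singFactor_sub_one hh)).hasProd
    (Eventually.of_forall fun _ => Finset.prod_nonneg fun p _ => singFactor_nonneg h p.2)

theorem summable_mean_bound (k : ℕ) : Summable fun p : Nat.Primes =>
    2 ^ k * ((k : ℝ) ^ 2 + (k : ℝ) ^ 3) * (1 / ((p : ℕ) : ℝ)) ^ 2 :=
  summable_one_div_primes_sq.mul_left _

theorem exists_tendsto_mean_comp_singSeries {k : ℕ} (hk : 1 ≤ k) {f : ℝ → ℝ} (hf : Continuous f)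
    {M : ℝ} (hM : ∀ x, |f x| ≤ M) :
    ∃ L : ℝ, Tendsto (fun H : ℕ => (∑ h ∈ distinctTuples k H, f (singSeries h)) / (H : ℝ) ^ k)
      atTop (𝓝 L) := by
  refine cauchySeq_tendsto_of_complete (Metric.cauchySeq_iff.2 fun ε hε => ?_)
  obtain ⟨F, hF⟩ := exists_finset_forall_abs_sum_sub_sum_le (distinctTuples k)
    (fun H => (H : ℝ) ^ k) (fun (h : Fin k → ℕ) (p : Nat.Primes) => singFactor h p)
    (summable_mean_bound k) (fun p => by positivity) (card_distinctTuples_le k)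
    (fun H h hh => summable_abs_singFactor_sub_one (Finset.mem_filter.1 hh).2)
    (fun H p => sum_abs_singFactor_sub_one_le hk H p.2) hf hM (show 0 < ε / 4 by positivity)
  obtain ⟨L, hL⟩ := exists_tendsto_mean_comp_prod_singFactor hk F hM
  obtain ⟨N, hN⟩ := Metric.cauchySeq_iff.1 hL.cauchySeq (ε / 4) (by positivity)
  have hclose : ∀ H : ℕ, dist ((∑ h ∈ distinctTuples k H, f (singSeries h)) / (H : ℝ) ^ k)
      ((∑ h ∈ distinctTuples k H, f (∏ p ∈ F, singFactor h p)) / (H : ℝ) ^ k) ≤ ε / 4 := by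
    intro H
    rw [Real.dist_eq, ← sub_div, abs_div, abs_of_nonneg (show (0 : ℝ) ≤ (H : ℝ) ^ k by positivity)]
    exact div_le_of_le_mul₀ (by positivity) (by positivity) (hF H)
  refine ⟨N, fun m hm n hn => ?_⟩
  have h1 := hclose m
  have h2 := hclose n
  rw [dist_comm] at h2
  refine (dist_triangle4 _ _ _ _).trans_lt
    (add_lt_add_of_lt_of_le (add_lt_add_of_le_of_lt h1 (hN m hm n hn)) h2 |>.trans ?_)
  linarith

/-- The uniform probability measure on the values of `g` on `T`, with multiplicity. -/
noncomputable def empiricalMeasure {α : Type*} (T : Finset α) (g : α → ℝ) : Measure ℝ :=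
  (T.card : ENNReal)⁻¹ • ∑ h ∈ T, Measure.dirac (g h)

theorem isProbabilityMeasure_empiricalMeasure {α : Type*} {T : Finset α} (hT : T.Nonempty)
    (g : α → ℝ) : IsProbabilityMeasure (empiricalMeasure T g) := by
  constructor
  simp only [empiricalMeasure, Measure.smul_apply, Measure.finsetSum_apply, measure_univ,
    Finset.sum_const, nsmul_eq_mul, mul_one, smul_eq_mul]
  exact ENNReal.inv_mul_cancel (by simpa using hT.ne_empty) (ENNReal.natCast_ne_top _)

theorem integral_empiricalMeasure {α : Type*} (T : Finset α) (g : α → ℝ) (f : ℝ → ℝ) :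
    ∫ x, f x ∂(empiricalMeasure T g) = (∑ h ∈ T, f (g h)) / T.card := by
  rw [empiricalMeasure, integral_smul_measure, integral_finsetSum_measure fun h _ => by
    exact integrable_dirac (by finiteness)]
  simp [div_eq_inv_mul]

theorem empiricalMeasure_apply {α : Type*} (T : Finset α) (g : α → ℝ) {s : Set ℝ}
    [DecidablePred (· ∈ s)] (hs : MeasurableSet s) :
    empiricalMeasure T g s = (T.card : ENNReal)⁻¹ * (T.filter fun h => g h ∈ s).card := by
  classical
  simp only [empiricalMeasure, Measure.smul_apply, Measure.finsetSum_apply, smul_eq_mul,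
    Measure.dirac_apply' _ hs, Set.indicator_apply, Pi.one_apply, Finset.sum_boole]

theorem distinctTuples_nonempty {k H : ℕ} (h : k ≤ H) : (distinctTuples k H).Nonempty := by
  refine ⟨fun i => i + 1, Finset.mem_filter.2 ⟨Fintype.mem_piFinset.2 fun i => ?_, ?_⟩⟩
  · have := i.2
    simp only [Finset.mem_Icc]
    omega
  · intro i j hij
    ext
    simpa using hij

theorem exists_forall_empiricalMeasure_compl_le {k : ℕ} (hk : 1 ≤ k) {m : ℕ} (hkm : k ≤ m)
    (hm : ∀ H, m ≤ H → (H : ℝ) ^ k ≤ 2 * (distinctTuples k H).card) {ε : ENNReal} (hε : 0 < ε) :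
    ∃ R : ℝ, ∀ H, m ≤ H →
      empiricalMeasure (distinctTuples k H) singSeries (Set.Icc (-R) R)ᶜ ≤ ε := by
  obtain ⟨δ, hδ0, hδε⟩ : ∃ δ : NNReal, 0 < δ ∧ (δ : ENNReal) < ε := by
    obtain ⟨δ, h1, h2⟩ := ENNReal.lt_iff_exists_nnreal_btwn.1 hε
    exact ⟨δ, by exact_mod_cast h1, h2⟩
  obtain ⟨R, hR⟩ := exists_forall_card_lt_abs_tprod_le (distinctTuples k)
    (fun H => (H : ℝ) ^ k) (fun (h : Fin k → ℕ) (p : Nat.Primes) => singFactor h p)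
    (summable_mean_bound k) (fun p => by positivity) (fun H => by positivity)
    (fun H h hh => summable_abs_singFactor_sub_one (Finset.mem_filter.1 hh).2)
    (fun H p => sum_abs_singFactor_sub_one_le hk H p.2) (show (0 : ℝ) < δ / 2 by positivity)
  refine ⟨R, fun H hH => ?_⟩
  classical
  rw [empiricalMeasure_apply _ _ measurableSet_Icc.compl]
  have hfil : ((distinctTuples k H).filter fun h => singSeries h ∈ (Set.Icc (-R) R)ᶜ) =
      (distinctTuples k H).filter fun h => R < |∏' p : Nat.Primes, singFactor h p| := by
    refine Finset.filter_congr fun h _ => ?_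
    rw [Set.mem_compl_iff, Set.mem_Icc, ← abs_le, not_le, singSeries]
  rw [hfil]
  have h1 : (((distinctTuples k H).filter fun h =>
      R < |∏' p : Nat.Primes, singFactor h p|).card : ℝ) ≤ δ * (distinctTuples k H).card := by
    have := mul_le_mul_of_nonneg_left (hm H hH) (show (0 : ℝ) ≤ δ / 2 by positivity)
    linarith [hR H]
  have h2 : (((distinctTuples k H).filter fun h =>
      R < |∏' p : Nat.Primes, singFactor h p|).card : ENNReal) ≤
        δ * ((distinctTuples k H).card : ENNReal) := by exact_mod_cast h1
  have h0 : (distinctTuples k H).card ≠ 0 := (distinctTuples_nonempty (hkm.trans hH)).card_ne_zero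
  rw [mul_comm, ← div_eq_mul_inv]
  refine (ENNReal.div_le_of_le_mul h2).trans hδε.le

theorem measure_Iio_zero_of_integral_eq_zero {ν : Measure ℝ} [IsFiniteMeasure ν]
    (h : ∫ x, max 0 (min 1 (-x)) ∂ν = 0) : ν (Set.Iio 0) = 0 := by
  have hfint : Integrable (fun x : ℝ => max 0 (min 1 (-x))) ν := by
    refine Integrable.of_bound (C := 1) (by fun_prop) (Eventually.of_forall fun x => ?_)
    rw [Real.norm_eq_abs, abs_of_nonneg (le_max_left _ _)]
    exact max_le zero_le_one (min_le_left _ _)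
  have hae := (integral_eq_zero_iff_of_nonneg (f := fun x : ℝ => max 0 (min 1 (-x)))
    (fun x => le_max_left _ _) hfint).1 h
  refine measure_mono_null (fun x hx => ?_) hae
  have hx' : 0 < -x := neg_pos.2 hx
  have : 0 < max 0 (min 1 (-x)) := lt_max_of_lt_right (lt_min one_pos hx')
  exact this.ne'

/-- Existence of a limiting distribution for the singular series: for fixed `k ≥ 1`
there is a Borel probability measure `ν_k` on `ℝ` supported on `[0, ∞)` such that for
every bounded continuous `f : ℝ → ℝ`, the average of `f(S(h))` over `k`-tuples of
distinct positive integers with entries at most `H` tends to `∫ f dν_k`. -/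
theorem limiting_distribution (k : ℕ) (hk : 1 ≤ k) :
    ∃ ν : Measure ℝ, IsProbabilityMeasure ν ∧ ν (Set.Iio 0) = 0 ∧
      ∀ f : ℝ → ℝ, Continuous f → (∃ M : ℝ, ∀ x, |f x| ≤ M) →
        Tendsto
          (fun H : ℕ => (∑ h ∈ distinctTuples k H, f (singSeries h)) / (H : ℝ) ^ k)
          atTop (𝓝 (∫ x, f x ∂ν)) := by
  obtain ⟨m, hkm, hm⟩ : ∃ m, k ≤ m ∧
      ∀ H, m ≤ H → (H : ℝ) ^ k ≤ 2 * (distinctTuples k H).card := by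
    have h1 := (tendsto_card_distinctTuples_div hk).eventually (lt_mem_nhds one_half_lt_one)
    obtain ⟨m, hm⟩ := eventually_atTop.1 (h1.and (eventually_gt_atTop 0))
    refine ⟨max k m, le_max_left _ _, fun H hH => ?_⟩
    obtain ⟨h2, h3⟩ := hm H ((le_max_right _ _).trans hH)
    have h4 : (0 : ℝ) < (H : ℝ) ^ k := by positivity
    rw [lt_div_iff₀ h4] at h2
    linarith
  let μ : ℕ → ProbabilityMeasure ℝ := fun n =>
    ⟨empiricalMeasure (distinctTuples k (n + m)) singSeries,
      isProbabilityMeasure_empiricalMeasure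
        (distinctTuples_nonempty (hkm.trans (Nat.le_add_left m n))) _⟩
  have htight : IsTightMeasureSet {((ρ : ProbabilityMeasure ℝ) : Measure ℝ) | ρ ∈ Set.range μ} := by
    rw [isTightMeasureSet_iff_exists_isCompact_measure_compl_le]
    intro ε hε
    obtain ⟨R, hR⟩ := exists_forall_empiricalMeasure_compl_le hk hkm hm hε
    refine ⟨Set.Icc (-R) R, isCompact_Icc, ?_⟩
    rintro _ ⟨_, ⟨n, rfl⟩, rfl⟩
    exact hR _ (Nat.le_add_left m n)
  obtain ⟨ν, -, φ, hφ, hν⟩ := (isCompact_closure_of_isTightMeasureSet htight).tendsto_subseq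
    fun n => subset_closure (Set.mem_range_self n)
  rw [ProbabilityMeasure.tendsto_iff_forall_integral_tendsto] at hν
  have hmain : ∀ f : ℝ → ℝ, Continuous f → (∃ M : ℝ, ∀ x, |f x| ≤ M) →
      Tendsto (fun H : ℕ => (∑ h ∈ distinctTuples k H, f (singSeries h)) / (H : ℝ) ^ k)
        atTop (𝓝 (∫ x, f x ∂(ν : Measure ℝ))) := by
    rintro f hf ⟨M, hM⟩
    obtain ⟨L, hL⟩ := exists_tendsto_mean_comp_singSeries hk hf hM
    have hdiv : Tendsto (fun H : ℕ =>
        (∑ h ∈ distinctTuples k H, f (singSeries h)) / (distinctTuples k H).card)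
        atTop (𝓝 L) := by
      have h := hL.div (tendsto_card_distinctTuples_div hk) one_ne_zero
      rw [div_one] at h
      refine h.congr' ?_
      filter_upwards [eventually_gt_atTop 0] with H hH
      have h4 : (H : ℝ) ^ k ≠ 0 := by positivity
      exact div_div_div_cancel_right₀ h4 _ _
    have hsub := hdiv.comp ((tendsto_add_atTop_nat m).comp hφ.tendsto_atTop)
    have hlim := hν (BoundedContinuousFunction.ofNormedAddCommGroup f hf M hM)
    have heq : L = ∫ x, f x ∂(ν : Measure ℝ) := by
      refine tendsto_nhds_unique hsub (hlim.congr fun n => ?_)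
      exact integral_empiricalMeasure (distinctTuples k (φ n + m)) singSeries f
    rwa [← heq]
  refine ⟨ν, inferInstance, measure_Iio_zero_of_integral_eq_zero ?_, hmain⟩
  refine tendsto_nhds_unique (hmain (fun x => max 0 (min 1 (-x))) (by fun_prop) ⟨1, fun x => ?_⟩)
    (tendsto_const_nhds.congr fun H => ?_)
  · rw [abs_of_nonneg (le_max_left _ _)]
    exact max_le zero_le_one (min_le_left _ _)
  · rw [Finset.sum_eq_zero fun h hh => ?_, zero_div]
    have := singSeries_nonneg (Finset.mem_filter.1 hh).2
    exact max_eq_left ((min_le_right _ _).trans (neg_nonpos.2 this))
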